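/- Let X be a compact metric space and f : X → X a continuous map with the s-limit shadowing property. Let C be a chain component of f and D ∈ 𝒟(C). Then for any x, y ∈ V^s(D) and any ε > 0, there exists z ∈ V^s(D) such that d(y, z) ≤ ε and lim_{i→∞} d(f^i(x), f^i(z)) = 0. -/

import Mathlib

open Filter Metric Set Topology

section Defs

variable {X : Type*} [MetricSpace X]

/-- A δ-chain of `f` of length `k` (with `k ≥ 1`) within the set `C`, from `x` to `y`. -/
def ChainIn (f : X → X) (C : Set X) (δ : ℝ) (k : ℕ) (x y : X) : Prop :=
  1 ≤ k ∧ ∃ c : ℕ → X, c 0 = x ∧ c k = y ∧ (∀ i ≤ k, c i ∈ C) ∧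
    ∀ i < k, dist (f (c i)) (c (i + 1)) ≤ δ

/-- `x → y` : for every `δ > 0` there is a `δ`-chain of `f` from `x` to `y`. -/
def ChainReach (f : X → X) (x y : X) : Prop :=
  ∀ δ > 0, ∃ k, ChainIn f Set.univ δ k x y

/-- `x` is chain recurrent for `f`. -/
def ChainRecurrent (f : X → X) (x : X) : Prop := ChainReach f x x

/-- `C` is a chain component of `f`: an equivalence class of the relation `↔`
on the set of chain recurrent points. -/
def IsChainComponent (f : X → X) (C : Set X) : Prop :=
  ∃ x, ChainRecurrent f x ∧
    C = {y | ChainRecurrent f y ∧ ChainReach f x y ∧ ChainReach f y x}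

/-- The set of lengths of δ-cycles of `f` restricted to `C`. -/
def cycleLengths (f : X → X) (C : Set X) (δ : ℝ) : Set ℕ :=
  {k | ∃ x ∈ C, ChainIn f C δ k x x}

/-- The greatest common divisor of a set of natural numbers
(the greatest natural number dividing every element). -/
noncomputable def setGcd (S : Set ℕ) : ℕ := sSup {d | ∀ k ∈ S, d ∣ k}

/-- `x ∼_{C,δ} y` : there is a δ-chain of `f|_C` from `x` to `y` whose length is
divisible by `m(C,δ)`, the gcd of the lengths of all δ-cycles of `f|_C`. -/
def SimCd (f : X → X) (C : Set X) (δ : ℝ) (x y : X) : Prop :=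
  ∃ k, setGcd (cycleLengths f C δ) ∣ k ∧ ChainIn f C δ k x y

/-- `x ∼_C y` : `x ∼_{C,δ} y` for all `δ > 0`. -/
def SimC (f : X → X) (C : Set X) (x y : X) : Prop :=
  ∀ δ > 0, SimCd f C δ x y

/-- `𝒟(C,δ)` : the set of equivalence classes of `∼_{C,δ}`. -/
def DClassesd (f : X → X) (C : Set X) (δ : ℝ) : Set (Set X) :=
  {D | ∃ x ∈ C, D = {y ∈ C | SimCd f C δ x y}}

/-- `𝒟(C)` : the set of equivalence classes of `∼_C`. -/
def DClasses (f : X → X) (C : Set X) : Set (Set X) :=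
  {D | ∃ x ∈ C, D = {y ∈ C | SimC f C x y}}

/-- `W^s(C) = {x : lim_{i→∞} d(f^i(x), C) = 0}`. -/
def wStable (f : X → X) (C : Set X) : Set X :=
  {x | Tendsto (fun i => infDist (f^[i] x) C) atTop (nhds 0)}

/-- `V^s(D) = ⋂_{δ>0} {x ∈ W^s(C) : lim_{i→∞} d(f^i(x), f^i(D_δ)) = 0}`, where
`D_δ` is the unique element of `𝒟(C,δ)` containing `D`. -/
def vStable (f : X → X) (C D : Set X) : Set X :=
  {x | x ∈ wStable f C ∧ ∀ δ > 0, ∀ Dd ∈ DClassesd f C δ, D ⊆ Dd →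
    Tendsto (fun i => infDist (f^[i] x) (f^[i] '' Dd)) atTop (nhds 0)}

/-- The s-limit shadowing property. -/
def SLimitShadowing (f : X → X) : Prop :=
  ∀ ε > 0, ∃ δ > 0, ∀ x : ℕ → X,
    (∀ i, dist (f (x i)) (x (i + 1)) ≤ δ) →
    Tendsto (fun i => dist (f (x i)) (x (i + 1))) atTop (nhds 0) →
    ∃ z : X, (∀ i, dist (f^[i] z) (x i) ≤ ε) ∧
      Tendsto (fun i => dist (f^[i] z) (x i)) atTop (nhds 0)

/-- The limit shadowing property. -/
def LimitShadowing (f : X → X) : Prop :=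
  ∀ x : ℕ → X, Tendsto (fun i => dist (f (x i)) (x (i + 1))) atTop (nhds 0) →
    ∃ z : X, Tendsto (fun i => dist (f^[i] z) (x i)) atTop (nhds 0)

/-- The (plain) shadowing property. -/
def ShadowingProperty (f : X → X) : Prop :=
  ∀ ε > 0, ∃ δ > 0, ∀ x : ℕ → X, (∀ i, dist (f (x i)) (x (i + 1)) ≤ δ) →
    ∃ z : X, ∀ i, dist (f^[i] z) (x i) ≤ ε

/-- A Furstenberg family: hereditary upward and proper. -/
def FurstenbergFamily (F : Set (Set ℕ)) : Prop :=
  (∀ A B : Set ℕ, A ∈ F → A ⊆ B → B ∈ F) ∧ F.Nonempty ∧ F ≠ Set.univ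

/-- A full Furstenberg family. -/
def FullFamily (F : Set (Set ℕ)) : Prop :=
  ∀ A ∈ F, ∀ n : ℕ, {i ∈ A | n ≤ i} ∈ F

/-- A translation invariant Furstenberg family. -/
def TranslationInvariantFamily (F : Set (Set ℕ)) : Prop :=
  ∀ A ∈ F, ∀ n : ℕ, ((fun i => i + n) '' A ∈ F ∧ {i | i + n ∈ A} ∈ F)

/-- `S_f(x₁,…,xₙ; r) = {i : min_{j<k} d(fⁱ(x_j), fⁱ(x_k)) > r}`. -/
def Sset (f : X → X) {n : ℕ} (x : Fin n → X) (r : ℝ) : Set ℕ :=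
  {i | ∀ j k : Fin n, j < k → r < dist (f^[i] (x j)) (f^[i] (x k))}

/-- `T_f(x₁,…,xₙ; r) = {i : max_{j<k} d(fⁱ(x_j), fⁱ(x_k)) < r}`. -/
def Tset (f : X → X) {n : ℕ} (x : Fin n → X) (r : ℝ) : Set ℕ :=
  {i | ∀ j k : Fin n, j < k → dist (f^[i] (x j)) (f^[i] (x k)) < r}

/-- `(x₁,…,xₙ)` is an `(ℱ,𝒢)`-δ-scrambled n-tuple for `f`. -/
def Scrambled (f : X → X) (F G : Set (Set ℕ)) (δ : ℝ) {n : ℕ} (x : Fin n → X) : Prop :=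
  Sset f x δ ∈ F ∧ ∀ ε > 0, Tset f x ε ∈ G

/-- `Y` is dense `(ℱ,𝒢)`-n-δ-chaotic for `f`: the `(ℱ,𝒢)`-δ-scrambled n-tuples in `Yⁿ`
form a dense subset of `Yⁿ`. -/
def DenseChaotic (f : X → X) (F G : Set (Set ℕ)) (n : ℕ) (δ : ℝ) (Y : Set X) : Prop :=
  {x : Fin n → X | ∀ j, x j ∈ Y} ⊆
    closure {x : Fin n → X | (∀ j, x j ∈ Y) ∧ Scrambled f F G δ x}

/-- `S` is a residual subset of the subspace `T`: it contains a countable intersection of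
dense open subsets of `T`. -/
def ResidualIn {α : Type*} [TopologicalSpace α] (T S : Set α) : Prop :=
  ∃ U : ℕ → Set α, (∀ i, IsOpen (U i)) ∧ (∀ i, T ⊆ closure (U i ∩ T)) ∧
    (⋂ i, U i) ∩ T ⊆ S

/-- `Y` is generic `(ℱ,𝒢)`-n-δ-chaotic for `f`: the `(ℱ,𝒢)`-δ-scrambled n-tuples in `Yⁿ`
form a residual subset of `Yⁿ`. -/
def GenericChaotic (f : X → X) (F G : Set (Set ℕ)) (n : ℕ) (δ : ℝ) (Y : Set X) : Prop :=
  ResidualIn {x : Fin n → X | ∀ j, x j ∈ Y}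
    {x : Fin n → X | (∀ j, x j ∈ Y) ∧ Scrambled f F G δ x}

/-- A Furstenberg family `F` is compatible with `(Z, g)`. -/
def CompatibleFamily {Z : Type*} [TopologicalSpace Z] (F : Set (Set ℕ)) (g : Z → Z) : Prop :=
  ∀ U : Set Z, IsOpen U → IsGδ {z | {i | g^[i] z ∈ U} ∈ F}

end Defs

namespace ChainIn

variable {X : Type*} [MetricSpace X] {f : X → X} {C C' : Set X} {δ η : ℝ} {k l : ℕ} {x y z : X}

theorem mono (h : ChainIn f C δ k x y) (hC : C ⊆ C') (hδ : δ ≤ η) : ChainIn f C' η k x y := by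
  obtain ⟨hk, c, h0, h1, hc, hd⟩ := h
  exact ⟨hk, c, h0, h1, fun i hi => hC (hc i hi), fun i hi => (hd i hi).trans hδ⟩

theorem left_mem (h : ChainIn f C δ k x y) : x ∈ C := by
  obtain ⟨hk, c, rfl, h1, hc, hd⟩ := h
  exact hc 0 (Nat.zero_le _)

theorem right_mem (h : ChainIn f C δ k x y) : y ∈ C := by
  obtain ⟨hk, c, h0, rfl, hc, hd⟩ := h
  exact hc k le_rfl

theorem trans (h : ChainIn f C δ k x y) (h' : ChainIn f C δ l y z) :
    ChainIn f C δ (k + l) x z := by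
  obtain ⟨hk, c, h0, h1, hc, hd⟩ := h
  obtain ⟨hl, c', h0', h1', hc', hd'⟩ := h'
  refine ⟨by omega, fun i => if i < k then c i else c' (i - k), ?_, ?_, ?_, ?_⟩
  · simp only [if_pos (show 0 < k by omega), h0]
  · simp [h1']
  · intro i hi
    dsimp only
    split_ifs with h
    · exact hc i h.le
    · exact hc' _ (by omega)
  · intro i hi
    dsimp only
    rcases lt_trichotomy (i + 1) k with h | h | h
    · rw [if_pos (by omega), if_pos h]
      exact hd i (by omega)
    · rw [if_pos (by omega), if_neg (by omega), show i + 1 - k = 0 by omega, h0', ← h1, ← h]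
      exact hd i (by omega)
    · rw [if_neg (by omega), if_neg (by omega), show i + 1 - k = i - k + 1 by omega]
      exact hd' _ (by omega)

theorem change_right (h : ChainIn f C δ k x y) (hz : z ∈ C) (hη : dist y z ≤ η) :
    ChainIn f C (δ + η) k x z := by
  obtain ⟨hk, c, h0, h1, hc, hd⟩ := h
  refine ⟨hk, Function.update c k z, ?_, by simp, ?_, ?_⟩
  · rw [Function.update_of_ne (by omega), h0]
  · intro i hi
    by_cases h : i = k
    · simpa [h] using hz
    · simpa [h] using hc i hi
  · intro i hi
    rw [Function.update_of_ne hi.ne]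
    by_cases h : i + 1 = k
    · rw [h, Function.update_self]
      have := hd i hi
      rw [h, h1] at this
      linarith [dist_triangle (f (c i)) y z]
    · rw [Function.update_of_ne h]
      linarith [hd i hi, dist_nonneg (x := y) (y := z)]

theorem change_left (h : ChainIn f C δ k x y) (hz : z ∈ C) (hη : dist (f z) (f x) ≤ η) :
    ChainIn f C (δ + η) k z y := by
  obtain ⟨hk, c, h0, h1, hc, hd⟩ := h
  refine ⟨hk, Function.update c 0 z, by simp, ?_, ?_, ?_⟩
  · rw [Function.update_of_ne (by omega), h1]
  · intro i hi
    by_cases h : i = 0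
    · simpa [h] using hz
    · simpa [h] using hc i hi
  · intro i hi
    rw [Function.update_of_ne (Nat.succ_ne_zero i)]
    by_cases h : i = 0
    · subst h
      rw [Function.update_self]
      have := hd 0 hi
      rw [h0] at this
      linarith [dist_triangle (f z) (f x) (c (0 + 1))]
    · rw [Function.update_of_ne h]
      linarith [hd i hi, dist_nonneg (x := f z) (y := f x)]

theorem iterate (hf : MapsTo f C C) (hδ : 0 ≤ δ) (hk : 1 ≤ k) (hx : x ∈ C) :
    ChainIn f C δ k x (f^[k] x) := by
  refine ⟨hk, fun i => f^[i] x, rfl, rfl, fun i _ => hf.iterate i hx, fun i _ => ?_⟩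
  dsimp only
  rw [Function.iterate_succ_apply', dist_self]
  exact hδ

end ChainIn

section ChainRecurrence

variable {X : Type*} [MetricSpace X] {f : X → X}

theorem ChainReach.trans {x y z : X} (h : ChainReach f x y) (h' : ChainReach f y z) :
    ChainReach f x z := by
  intro δ hδ
  obtain ⟨k, hk⟩ := h δ hδ
  obtain ⟨l, hl⟩ := h' δ hδ
  exact ⟨_, hk.trans hl⟩

theorem ChainReach.map_self (x : X) : ChainReach f x (f x) := fun _ hδ =>
  ⟨1, ChainIn.iterate (mapsTo_univ _ _) hδ.le le_rfl (mem_univ _)⟩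

theorem ChainRecurrent.chainReach_map {x : X} (hf : Continuous f) (h : ChainRecurrent f x) :
    ChainReach f (f x) x := by
  intro δ hδ
  obtain ⟨η, hη, hηf⟩ := Metric.continuousAt_iff.1 (hf.continuousAt (x := f x)) (δ / 2)
    (half_pos hδ)
  obtain ⟨k, hk⟩ := h (min (δ / 2) (η / 2)) (by positivity)
  obtain ⟨hk1, c, h0, h1, hc, hd⟩ := hk.trans hk
  have h2 : ChainIn f univ (δ / 2) (k + k - 1) (c 1) x := by
    refine ⟨by have := hk.1; omega, fun i => c (i + 1), rfl, ?_, fun _ _ => mem_univ _, ?_⟩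
    · dsimp only
      rw [Nat.sub_add_cancel hk1, h1]
    · intro i hi
      exact (hd (i + 1) (by omega)).trans (min_le_left _ _)
  have h3 : dist (f x) (c 1) < η := by
    have := hd 0 (by omega)
    rw [h0] at this
    linarith [this.trans (min_le_right _ _)]
  refine ⟨_, (h2.change_left (mem_univ (f x)) (η := δ / 2) ?_).mono subset_rfl (by linarith)⟩
  rw [dist_comm]
  exact (hηf (by rwa [dist_comm])).le

theorem IsChainComponent.chainReach {C : Set X} (hC : IsChainComponent f C) {x y : X}
    (hx : x ∈ C) (hy : y ∈ C) : ChainReach f x y := by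
  obtain ⟨a, -, rfl⟩ := hC
  exact hx.2.2.trans hy.2.1

theorem IsChainComponent.mem_of_chainReach {C : Set X} (hC : IsChainComponent f C) {x y : X}
    (hx : x ∈ C) (hxy : ChainReach f x y) (hyx : ChainReach f y x) : y ∈ C := by
  obtain ⟨a, -, rfl⟩ := hC
  exact ⟨hyx.trans hxy, hx.2.1.trans hxy, hyx.trans hx.2.2⟩

theorem IsChainComponent.mapsTo {C : Set X} (hC : IsChainComponent f C) (hf : Continuous f) :
    MapsTo f C C := fun _ hx =>
  hC.mem_of_chainReach hx (.map_self _) (ChainRecurrent.chainReach_map hf (hC.chainReach hx hx))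

/-- Points lying on arbitrarily fine chains between two points of a chain component accumulate
only on that component. -/
theorem IsChainComponent.exists_infDist_lt [CompactSpace X] {C : Set X}
    (hC : IsChainComponent f C) (hf : Continuous f) {p q : X} (hp : p ∈ C) (hq : q ∈ C)
    {η : ℝ} (hη : 0 < η) :
    ∃ γ > 0, ∀ w k l, ChainIn f univ γ k p w → ChainIn f univ γ l w q → infDist w C < η := by
  by_contra! hcon
  choose w k l hk hl hw using fun n : ℕ => hcon (1 / ((n : ℝ) + 1)) (by positivity)
  obtain ⟨a, φ, hφ, ha⟩ := CompactSpace.tendsto_subseq w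
  have hlim : Tendsto (fun n : ℕ => 1 / ((φ n : ℝ) + 1)) atTop (nhds 0) :=
    tendsto_one_div_add_atTop_nhds_zero_nat.comp hφ.tendsto_atTop
  have hpa : ChainReach f p a := by
    intro δ hδ
    have h1 := hlim.eventually_lt_const (half_pos hδ)
    have h2 := (Metric.tendsto_nhds.1 ha) (δ / 2) (half_pos hδ)
    obtain ⟨n, h1, h2⟩ := (h1.and h2).exists
    exact ⟨_, ((hk (φ n)).change_right (mem_univ a) h2.le).mono subset_rfl (by linarith)⟩
  have haq : ChainReach f a q := by
    intro δ hδ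
    have h1 := hlim.eventually_lt_const (half_pos hδ)
    have h2 := (Metric.tendsto_nhds.1 ((hf.tendsto a).comp ha)) (δ / 2) (half_pos hδ)
    obtain ⟨n, h1, h2⟩ := (h1.and h2).exists
    exact ⟨_, ((hl (φ n)).change_left (mem_univ a) (η := δ / 2)
      (by rw [dist_comm]; exact h2.le)).mono
      subset_rfl (by linarith)⟩
  have haC : a ∈ C := hC.mem_of_chainReach hp hpa (haq.trans (hC.chainReach hq hp))
  obtain ⟨n, hn⟩ := ((Metric.tendsto_nhds.1 ha) η hη).exists
  exact absurd ((infDist_le_dist_of_mem haC).trans_lt hn) (not_lt.2 (hw (φ n)))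

/-- The restriction of `f` to a chain component is chain transitive. -/
theorem IsChainComponent.exists_chainIn [CompactSpace X] {C : Set X}
    (hC : IsChainComponent f C) (hf : Continuous f) {p q : X} (hp : p ∈ C) (hq : q ∈ C)
    {δ : ℝ} (hδ : 0 < δ) : ∃ k, ChainIn f C δ k p q := by
  obtain ⟨η, hη, hηf⟩ := Metric.uniformContinuous_iff.1
    (CompactSpace.uniformContinuous_of_continuous hf) (δ / 3) (by positivity)
  obtain ⟨γ, hγ, H⟩ := hC.exists_infDist_lt hf hp hq (lt_min hη (show 0 < δ / 3 by positivity))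
  obtain ⟨k, hk1, c, h0, h1, -, hd⟩ :=
    hC.chainReach hp hq (min γ (δ / 3)) (lt_min hγ (by positivity))
  have hdγ : ∀ i < k, dist (f (c i)) (c (i + 1)) ≤ γ := fun i hi =>
    (hd i hi).trans (min_le_left _ _)
  have hex : ∀ i, ∃ a, (i ≤ k → a ∈ C ∧ dist (c i) a < min η (δ / 3)) ∧
      (i = 0 → a = p) ∧ (i = k → a = q) := by
    have hpos : 0 < min η (δ / 3) := lt_min hη (by positivity)
    intro i
    by_cases hi0 : i = 0
    · subst hi0
      exact ⟨p, fun _ => ⟨hp, by rwa [h0, dist_self]⟩, fun _ => rfl, fun h => by omega⟩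
    by_cases hik : i = k
    · subst hik
      exact ⟨q, fun _ => ⟨hq, by rwa [h1, dist_self]⟩, fun h => by omega, fun _ => rfl⟩
    by_cases hlt : i ≤ k
    · have hI : infDist (c i) C < min η (δ / 3) := by
        refine H (c i) i (k - i) ⟨by omega, c, h0, rfl, fun _ _ => mem_univ _,
          fun j hj => hdγ j (by omega)⟩ ⟨by omega, fun j => c (i + j), rfl, ?_,
          fun _ _ => mem_univ _, fun j hj => hdγ (i + j) (by omega)⟩
        dsimp only
        rw [Nat.add_sub_cancel' hlt, h1]
      obtain ⟨a, haC, ha⟩ := (infDist_lt_iff ⟨p, hp⟩).1 hI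
      exact ⟨a, fun _ => ⟨haC, ha⟩, fun h => absurd h hi0, fun h => absurd h hik⟩
    · exact ⟨p, fun h => absurd h hlt, fun h => absurd h hi0, fun h => absurd h hik⟩
  choose a ha ha0 hak using hex
  refine ⟨k, hk1, a, ha0 0 rfl, hak k rfl, fun i hi => (ha i hi).1, fun i hi => ?_⟩
  have e1 : dist (f (a i)) (f (c i)) < δ / 3 := by
    rw [dist_comm]
    exact hηf ((ha i hi.le).2.trans_le (min_le_left _ _))
  have e2 := (ha (i + 1) hi).2.trans_le (min_le_right _ _)
  have e3 := (hd i hi).trans (min_le_right _ _)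
  linarith [dist_triangle4 (f (a i)) (f (c i)) (c (i + 1)) (a (i + 1))]

end ChainRecurrence

section CyclicClasses

theorem setGcd_eq_natSetGcd {S : Set ℕ} {k : ℕ} (hk : k ∈ S) (hk0 : k ≠ 0) :
    setGcd S = Nat.setGcd S := by
  have hbdd : ∀ d, (∀ k ∈ S, d ∣ k) → d ≤ Nat.setGcd S := fun d hd =>
    Nat.le_of_dvd (Nat.pos_of_ne_zero fun h => hk0 (Nat.setGcd_eq_zero_iff.1 h hk))
      (Nat.dvd_setGcd_iff.2 hd)
  exact le_antisymm (csSup_le' hbdd)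
    (le_csSup ⟨_, hbdd⟩ fun _ h => Nat.setGcd_dvd_of_mem h)

variable {X : Type*} [MetricSpace X] {f : X → X} {C : Set X} {δ : ℝ}

theorem setGcd_cycleLengths_dvd {x : X} {k : ℕ} (h : ChainIn f C δ k x x) :
    setGcd (cycleLengths f C δ) ∣ k := by
  have hk : k ∈ cycleLengths f C δ := ⟨x, h.left_mem, h⟩
  rw [setGcd_eq_natSetGcd hk (Nat.one_le_iff_ne_zero.1 h.1)]
  exact Nat.setGcd_dvd_of_mem hk

/-- If `f` is `δ`-chain transitive on `C`, every large multiple of the global period is the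
length of a `δ`-cycle through any given point. -/
theorem exists_cycle_of_ge (htr : ∀ p ∈ C, ∀ q ∈ C, ∃ k, ChainIn f C δ k p q) {x : X}
    (hx : x ∈ C) :
    ∃ K, ∀ k ≥ K, setGcd (cycleLengths f C δ) ∣ k → ChainIn f C δ k x x := by
  set L : Set ℕ := {k | ChainIn f C δ k x x}
  have hdvd : Nat.setGcd L ∣ setGcd (cycleLengths f C δ) := by
    obtain ⟨k, hk⟩ := htr x hx x hx
    have hkL : k ∈ cycleLengths f C δ := ⟨x, hx, hk⟩
    rw [setGcd_eq_natSetGcd hkL (Nat.one_le_iff_ne_zero.1 hk.1), Nat.dvd_setGcd_iff]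
    rintro n ⟨r, hr, hn⟩
    obtain ⟨a, ha⟩ := htr x hx r hr
    obtain ⟨b, hb⟩ := htr r hr x hx
    have h1 : Nat.setGcd L ∣ a + b := Nat.setGcd_dvd_of_mem (ha.trans hb)
    have h2 : Nat.setGcd L ∣ a + n + b := Nat.setGcd_dvd_of_mem ((ha.trans hn).trans hb)
    rw [show a + n + b = (a + b) + n by ring] at h2
    exact (Nat.dvd_add_right h1).1 h2
  obtain ⟨K, hK⟩ := Nat.exists_mem_closure_of_ge L
  refine ⟨max K 1, fun k hk hm => ?_⟩
  have hcl : ∀ n ∈ AddSubmonoid.closure L, n = 0 ∨ ChainIn f C δ n x x := by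
    intro n hn
    induction hn using AddSubmonoid.closure_induction with
    | mem n hn => exact Or.inr hn
    | zero => exact Or.inl rfl
    | add a b _ _ ha hb =>
      rcases ha with rfl | ha
      · simpa using hb
      · rcases hb with rfl | hb
        · exact Or.inr ha
        · exact Or.inr (ha.trans hb)
  rcases hcl k (hK k (le_of_max_le_left hk) (hdvd.trans hm)) with h | h
  · have := le_of_max_le_right hk
    omega
  · exact h

theorem exists_chainIn_of_ge (htr : ∀ p ∈ C, ∀ q ∈ C, ∃ k, ChainIn f C δ k p q) {x p q : X}
    (hp : SimCd f C δ x p) (hq : SimCd f C δ x q) :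
    ∃ K, ∀ k ≥ K, setGcd (cycleLengths f C δ) ∣ k → ChainIn f C δ k p q := by
  obtain ⟨a, ha, hxp⟩ := hp
  obtain ⟨b, hb, hxq⟩ := hq
  obtain ⟨l, hpx⟩ := htr p hxp.right_mem x hxp.left_mem
  have hl : setGcd (cycleLengths f C δ) ∣ l :=
    (Nat.dvd_add_right ha).1 (setGcd_cycleLengths_dvd (hxp.trans hpx))
  obtain ⟨K, hK⟩ := exists_cycle_of_ge htr hxp.left_mem
  refine ⟨K + l + b, fun k hk hm => ?_⟩
  have := (hpx.trans (hK (k - l - b) (by omega)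
    (Nat.dvd_sub (Nat.dvd_sub hm hl) hb))).trans hxq
  rwa [show l + (k - l - b) + b = k by omega] at this

/-- A uniform length threshold on a finite set of pairwise equivalent points. -/
theorem exists_chainIn_of_ge_of_finite (htr : ∀ p ∈ C, ∀ q ∈ C, ∃ k, ChainIn f C δ k p q)
    {x : X} {t : Set X} (ht : t.Finite) (hts : ∀ p ∈ t, SimCd f C δ x p) :
    ∃ K, ∀ p ∈ t, ∀ q ∈ t, ∀ k ≥ K, setGcd (cycleLengths f C δ) ∣ k →
      ChainIn f C δ k p q := by
  have h : ∀ r : X × X, ∃ K, r ∈ t ×ˢ t → ∀ k ≥ K,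
      setGcd (cycleLengths f C δ) ∣ k → ChainIn f C δ k r.1 r.2 := by
    intro r
    by_cases hr : r ∈ t ×ˢ t
    · obtain ⟨K, hK⟩ := exists_chainIn_of_ge htr (hts _ hr.1) (hts _ hr.2)
      exact ⟨K, fun _ => hK⟩
    · exact ⟨0, fun h => absurd h hr⟩
  choose K hK using h
  obtain ⟨B, hB⟩ := ((ht.prod ht).image K).bddAbove
  exact ⟨B, fun p hp q hq k hk => hK (p, q) ⟨hp, hq⟩ k
    ((hB (mem_image_of_mem K (show (p, q) ∈ t ×ˢ t from ⟨hp, hq⟩))).trans hk)⟩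

theorem SimCd.iterate (hf : MapsTo f C C) (hδ : 0 ≤ δ) {x p : X} (h : SimCd f C δ x p) {n : ℕ}
    (hn : setGcd (cycleLengths f C δ) ∣ n) : SimCd f C δ x (f^[n] p) := by
  rcases Nat.eq_zero_or_pos n with rfl | hpos
  · exact h
  · obtain ⟨k, hk, hc⟩ := h
    exact ⟨k + n, dvd_add hk hn, hc.trans (.iterate hf hδ hpos hc.right_mem)⟩

end CyclicClasses

section StableSets

variable {X : Type*} [MetricSpace X] {f : X → X}

theorem tendsto_infDist_of_tendsto_dist {u v : ℕ → X} {S : ℕ → Set X}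
    (hu : Tendsto (fun i => infDist (u i) (S i)) atTop (nhds 0))
    (huv : Tendsto (fun i => dist (u i) (v i)) atTop (nhds 0)) :
    Tendsto (fun i => infDist (v i) (S i)) atTop (nhds 0) := by
  refine squeeze_zero (fun i => infDist_nonneg) (fun i => ?_) (by simpa using hu.add huv)
  rw [dist_comm]
  exact infDist_le_infDist_add_dist

theorem vStable_of_tendsto_dist {C D : Set X} {x z : X} (hx : x ∈ vStable f C D)
    (hxz : Tendsto (fun i => dist (f^[i] x) (f^[i] z)) atTop (nhds 0)) : z ∈ vStable f C D :=
  ⟨tendsto_infDist_of_tendsto_dist hx.1 hxz, fun δ hδ E hE hDE =>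
    tendsto_infDist_of_tendsto_dist (hx.2 δ hδ E hE hDE) hxz⟩

/-- Two points of `V^s(D)` can be joined by a pseudo-orbit which follows the orbit of the first
one and then, without a time shift, that of the second one. -/
theorem exists_chainIn_iterate [CompactSpace X] (hf : Continuous f) {C D : Set X}
    (hC : IsChainComponent f C) (hD : D ∈ DClasses f C) {x y : X} (hx : x ∈ vStable f C D)
    (hy : y ∈ vStable f C D) {δ : ℝ} (hδ : 0 < δ) :
    ∃ N M p q, 0 < N ∧ ChainIn f univ δ M p q ∧ dist (f^[N] y) p < δ ∧
      dist q (f^[N + M] x) < δ := by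
  obtain ⟨a, haC, rfl⟩ := hD
  have hδ2 := half_pos hδ
  have hmaps := hC.mapsTo hf
  have htr : ∀ p ∈ C, ∀ q ∈ C, ∃ k, ChainIn f C δ k p q := fun p hp q hq =>
    hC.exists_chainIn hf hp hq hδ
  set m := setGcd (cycleLengths f C δ)
  set E : Set X := {b ∈ C | SimCd f C δ a b}
  have haE : a ∈ E := by
    obtain ⟨k, hk⟩ := htr a haC a haC
    exact ⟨haC, k, setGcd_cycleLengths_dvd hk, hk⟩
  have hm0 : 0 < m := by
    obtain ⟨k, hk⟩ := htr a haC a haC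
    exact Nat.pos_of_dvd_of_pos (setGcd_cycleLengths_dvd hk) hk.1
  obtain ⟨t, htE, htfin, htcov⟩ := Metric.finite_approx_of_totallyBounded
    (isCompact_univ.totallyBounded.subset (subset_univ E)) (δ / 2) hδ2
  obtain ⟨K, hK⟩ := exists_chainIn_of_ge_of_finite htr htfin fun p hp => (htE hp).2
  have hnear : ∀ w ∈ vStable f C {b ∈ C | SimC f C a b},
      ∀ᶠ n in atTop, m ∣ n → ∃ p ∈ t, dist (f^[n] w) p < δ := by
    intro w hw
    have := hw.2 δ hδ E ⟨a, haC, rfl⟩ fun b hb => ⟨hb.1, hb.2 δ hδ⟩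
    filter_upwards [this.eventually_lt_const hδ2] with n hn hmn
    obtain ⟨_, ⟨b, hb, rfl⟩, hlt⟩ := (infDist_lt_iff (Set.Nonempty.image _ ⟨a, haE⟩)).1 hn
    have hbE : f^[n] b ∈ E := ⟨hmaps.iterate n hb.1, hb.2.iterate hmaps hδ.le hmn⟩
    obtain ⟨p, hpt, hp⟩ := mem_iUnion₂.1 (htcov hbE)
    rw [mem_ball] at hp
    exact ⟨p, hpt, by linarith [dist_triangle (f^[n] w) (f^[n] b) p]⟩
  obtain ⟨R, hR⟩ := eventually_atTop.1 ((hnear x hx).and (hnear y hy))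
  have hle : ∀ n, n ≤ m * (n + 1) := fun n => by nlinarith
  obtain ⟨p, hpt, hp⟩ := (hR (m * (R + 1)) (hle R)).2 (dvd_mul_right _ _)
  obtain ⟨q, hqt, hq⟩ := (hR (m * (R + 1) + m * (K + 1)) ((hle R).trans (Nat.le_add_right _ _))).1
    (dvd_add (dvd_mul_right _ _) (dvd_mul_right _ _))
  exact ⟨m * (R + 1), m * (K + 1), p, q, by positivity,
    (hK p hpt q hqt _ (hle K) (dvd_mul_right _ _)).mono (subset_univ _) le_rfl, hp,
    by rwa [dist_comm]⟩

end StableSets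

/-- Lemma 1.1: s-limit shadowing gives asymptotic approximation within `V^s(D)`. -/
theorem slimit_shadowing_asymptotic_in_vStable
    {X : Type*} [MetricSpace X] [CompactSpace X]
    (f : X → X) (hf : Continuous f) (hsls : SLimitShadowing f)
    (C : Set X) (hC : IsChainComponent f C) (D : Set X) (hD : D ∈ DClasses f C) :
    ∀ x ∈ vStable f C D, ∀ y ∈ vStable f C D, ∀ ε > 0,
      ∃ z ∈ vStable f C D, dist y z ≤ ε ∧
        Tendsto (fun i => dist (f^[i] x) (f^[i] z)) atTop (nhds 0) := by
  intro x hx y hy ε hε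
  obtain ⟨δ, hδ, hsh⟩ := hsls ε hε
  obtain ⟨N, M, p, q, hN, hchain, hp, hq⟩ :=
    exists_chainIn_iterate hf hC hD hx hy (half_pos hδ)
  obtain ⟨hM, c, h0, h1, -, hd⟩ := hchain.change_right (mem_univ _) hq.le
  rw [add_halves] at hd
  let s : ℕ → X := fun i =>
    if i < N then f^[i] y else if i ≤ N + M then c (i - N) else f^[i] x
  have hs_right : ∀ i, N + M ≤ i → s i = f^[i] x := by
    intro i hi
    simp only [s]
    rw [if_neg (by omega)]
    split_ifs with h
    · obtain rfl : i = N + M := le_antisymm h hi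
      rw [Nat.add_sub_cancel_left, h1]
    · rfl
  have hstep : ∀ i, N + M ≤ i → dist (f (s i)) (s (i + 1)) = 0 := by
    intro i hi
    rw [hs_right i hi, hs_right (i + 1) (by omega), Function.iterate_succ_apply', dist_self]
  have hs : ∀ i, dist (f (s i)) (s (i + 1)) ≤ δ := by
    intro i
    rcases le_or_gt (N + M) i with h | h
    · rw [hstep i h]
      exact hδ.le
    simp only [s]
    rcases lt_trichotomy (i + 1) N with h' | h' | h'
    · rw [if_pos (by omega), if_pos h', Function.iterate_succ_apply', dist_self]
      exact hδ.le
    · rw [if_pos (by omega), if_neg (by omega), if_pos (by omega), h', Nat.sub_self, h0,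
        ← Function.iterate_succ_apply' f, Nat.succ_eq_add_one, h']
      linarith
    · rw [if_neg (by omega), if_pos (by omega), if_neg (by omega), if_pos (by omega),
        show i + 1 - N = i - N + 1 by omega]
      exact hd _ (by omega)
  obtain ⟨z, hz, hzlim⟩ := hsh s hs (tendsto_const_nhds.congr'
    (eventually_atTop.2 ⟨N + M, fun i hi => (hstep i hi).symm⟩))
  have hxz : Tendsto (fun i => dist (f^[i] x) (f^[i] z)) atTop (nhds 0) :=
    hzlim.congr' (eventually_atTop.2 ⟨N + M, fun i hi => by
      dsimp only
      rw [hs_right i hi, dist_comm]⟩)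
  refine ⟨z, vStable_of_tendsto_dist hx hxz, ?_, hxz⟩
  have := hz 0
  simp only [s, if_pos hN, Function.iterate_zero_apply] at this
  rwa [dist_comm]
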